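/- arXiv:2602.19510 — 4 statements merged into one kernel-verified Lean document; each statement's English description precedes it below -/
import Mathlib

section
/- Consider the scalar quadratic data-mixing instance with L_T(θ, w) = w·θ²/2 + (1−w)·(θ−1)²/2 and L_V(θ) = θ²/2, run with inner updates θ_{k,t+1} = θ_{k,t} − η ∂_θ L_T(θ_{k,t}, w_k) (0 < η < 1), θ_{k+1,0} = θ_{k,T}, and weight updates w_{k+1} = w_k / (w_k + (1−w_k) exp(α ḡ_{k,T})) where ḡ_{k,T} = ∂L_V(θ_{k,T})/∂w_k = −θ_{k+1,0}(1 − (1−η)^T) and α > 0. Fix the total parameter-update budget N = K·T, start from w_0 = 1/2 and θ_{0,0} = −R with R > R̄ := ηN / ((1−η)(1 − (1−η)^N)). If T = T̄ = ⌈(c+1) log(2R+1) / log(1/(1−η))⌉ for some c > 0 and K = N/T̄, then the final weight satisfies w_K ≥ e^{β α/2} / (1 + e^{β α/2}), where β = (1 − (2R+1)^{−c})(1 − (2R+1)^{−K(c+1)}). -/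
open Real

/-- Scalar quadratic data-mixing instance, large-horizon case
(Case 1 of the formal version of Theorem 1).  The algorithm alternates rounds
`k = 0,…,K-1`: `T` inner gradient-descent steps on
`L_T(θ,w) = w θ²/2 + (1-w)(θ-1)²/2` with step size `η`, followed by one
exponentiated-gradient weight update with step size `α` using the exact
hypergradient `ḡ_{k,T} = -θ_{k+1,0}(1-(1-η)^T)`.  With budget `N = K·T`,
`w₀ = 1/2`, `θ_{0,0} = -R`, `R > R̄ := ηN/((1-η)(1-(1-η)^N))`, and
`T = ⌈(c+1) log(2R+1)/log(1/(1-η))⌉`, the final weight satisfies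
`w_K ≥ e^{βα/2}/(1+e^{βα/2})` with
`β = (1-(2R+1)^{-c})(1-(2R+1)^{-K(c+1)})`. -/
theorem stmt_2
    (η α c R : ℝ) (hη0 : 0 < η) (hη1 : η < 1) (hα : 0 < α) (hc : 0 < c)
    (N K T : ℕ) (hN : 0 < N)
    (hT : T = ⌈(c + 1) * Real.log (2 * R + 1) / Real.log (1 / (1 - η))⌉₊)
    (hKT : N = K * T)
    (hR : η * N / ((1 - η) * (1 - (1 - η) ^ N)) < R)
    (θ : ℕ → ℕ → ℝ) (w : ℕ → ℝ)
    (hw0 : w 0 = 1 / 2) (hθ00 : θ 0 0 = -R)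
    (hθupd : ∀ k t, θ k (t + 1) = θ k t - η * (w k * θ k t + (1 - w k) * (θ k t - 1)))
    (hlink : ∀ k, θ (k + 1) 0 = θ k T)
    (hwupd : ∀ k, w (k + 1) =
      w k / (w k + (1 - w k) *
        Real.exp (α * (-(θ (k + 1) 0) * (1 - (1 - η) ^ T))))) :
    Real.exp ((1 - (2 * R + 1) ^ (-c)) * (1 - (2 * R + 1) ^ (-((K : ℝ) * (c + 1)))) * (α / 2)) /
        (1 + Real.exp ((1 - (2 * R + 1) ^ (-c)) *
          (1 - (2 * R + 1) ^ (-((K : ℝ) * (c + 1)))) * (α / 2))) ≤ w K := by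
  have h1η : 0 < 1 - η := by linarith
  have hRpos : 0 < R := by
    have hNR : (0:ℝ) < N := by exact_mod_cast hN
    have h1 : (1 - η) ^ N < 1 := pow_lt_one₀ h1η.le (by linarith) hN.ne'
    have h2 : 0 < 1 - (1 - η) ^ N := by linarith
    have : 0 < η * N / ((1 - η) * (1 - (1 - η) ^ N)) := by positivity
    linarith
  have hTpos : T ≠ 0 := by
    rintro rfl
    simp at hKT
    omega
  have hS : 0 < 2 * R + 1 := by linarith
  obtain ⟨q, hq⟩ : ∃ q, q = (1 - η) ^ T := ⟨_, rfl⟩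
  have hq0 : 0 < q := by rw [hq]; positivity
  have hq1 : q < 1 := by rw [hq]; exact pow_lt_one₀ h1η.le (by linarith) hTpos
  have hqS : q ≤ (2 * R + 1) ^ (-(c + 1)) := by
    have hl : 0 < Real.log (1 / (1 - η)) := by
      apply Real.log_pos
      rw [lt_div_iff₀ h1η]; linarith
    have h1 : (c + 1) * Real.log (2 * R + 1) / Real.log (1 / (1 - η)) ≤ T := by
      rw [hT]; exact Nat.le_ceil _
    rw [div_le_iff₀ hl] at h1
    rw [one_div, Real.log_inv] at h1
    rw [← Real.log_le_log_iff hq0 (by positivity), Real.log_rpow hS, hq, Real.log_pow]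
    linarith
  have hθt : ∀ k t, θ k t = (1 - η) ^ t * θ k 0 + (1 - (1 - η) ^ t) * (1 - w k) := by
    intro k t
    induction t with
    | zero => simp
    | succ t ih => rw [hθupd, ih]; ring
  have hstep : ∀ k, θ (k + 1) 0 = q * θ k 0 + (1 - q) * (1 - w k) := by
    intro k
    rw [hlink, hθt, hq]
  rw [← hq] at hwupd
  have hw : ∀ k, w k = Real.exp (α * (1 - q) * ∑ i ∈ Finset.range k, θ (i + 1) 0) /
      (1 + Real.exp (α * (1 - q) * ∑ i ∈ Finset.range k, θ (i + 1) 0)) := by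
    intro k
    induction k with
    | zero => rw [hw0]; norm_num
    | succ k ih =>
      rw [hwupd, Finset.sum_range_succ, mul_add, Real.exp_add, ih]
      have e : α * (-(θ (k + 1) 0) * (1 - q)) = -(α * (1 - q) * θ (k + 1) 0) := by ring
      rw [e, Real.exp_neg]
      have ha := Real.exp_pos (α * (1 - q) * ∑ i ∈ Finset.range k, θ (i + 1) 0)
      have hb := Real.exp_pos (α * (1 - q) * θ (k + 1) 0)
      generalize Real.exp (α * (1 - q) * ∑ i ∈ Finset.range k, θ (i + 1) 0) = a at *
      generalize Real.exp (α * (1 - q) * θ (k + 1) 0) = b at *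
      have e2 : 1 - a / (1 + a) = 1 / (1 + a) := by field_simp; ring
      rw [e2]
      field_simp
      ring
  have hw1 : ∀ k, w k ≤ 1 := by
    intro k
    rw [hw, div_le_one (by positivity)]
    linarith
  have hθ1 : θ 1 0 = (1 - q * (2 * R + 1)) / 2 := by
    have := hstep 0
    rw [zero_add] at this
    rw [this, hθ00, hw0]; ring
  have hθk : ∀ k, q ^ k * θ 1 0 ≤ θ (k + 1) 0 := by
    intro k
    induction k with
    | zero => simp
    | succ k ih =>
      rw [hstep (k + 1), pow_succ]
      have h1 := mul_le_mul_of_nonneg_left ih hq0.le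
      have h2 : 0 ≤ (1 - q) * (1 - w (k + 1)) :=
        mul_nonneg (by linarith) (by linarith [hw1 (k + 1)])
      nlinarith
  have hsum : (1 - q ^ K) * θ 1 0 ≤ (1 - q) * ∑ i ∈ Finset.range K, θ (i + 1) 0 := by
    have h1 : ∑ i ∈ Finset.range K, q ^ i * θ 1 0 ≤ ∑ i ∈ Finset.range K, θ (i + 1) 0 :=
      Finset.sum_le_sum fun i _ => hθk i
    rw [← Finset.sum_mul] at h1
    have h2 := mul_le_mul_of_nonneg_left h1 (by linarith : 0 ≤ 1 - q)
    rw [← mul_assoc, mul_neg_geom_sum] at h2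
    exact h2
  have hA : q * (2 * R + 1) ≤ (2 * R + 1) ^ (-c) := by
    have h1 := mul_le_mul_of_nonneg_right hqS hS.le
    have h2 : (2 * R + 1) ^ (-(c + 1)) * (2 * R + 1) = (2 * R + 1) ^ (-c) := by
      rw [← Real.rpow_add_one hS.ne']; congr 1; ring
    linarith
  have hB : q ^ K ≤ (2 * R + 1) ^ (-((K : ℝ) * (c + 1))) := by
    have h1 := pow_le_pow_left₀ hq0.le hqS K
    have h2 : ((2 * R + 1) ^ (-(c + 1))) ^ K = (2 * R + 1) ^ (-((K : ℝ) * (c + 1))) := by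
      rw [← Real.rpow_mul_natCast hS.le]; congr 1; ring
    linarith
  have hA1 : (2 * R + 1) ^ (-c) ≤ 1 :=
    Real.rpow_le_one_of_one_le_of_nonpos (by linarith) (by linarith)
  have hK1 : q ^ K ≤ 1 := pow_le_one₀ hq0.le hq1.le
  have hz : (1 - (2 * R + 1) ^ (-c)) * (1 - (2 * R + 1) ^ (-((K : ℝ) * (c + 1)))) * (α / 2) ≤
      α * (1 - q) * ∑ i ∈ Finset.range K, θ (i + 1) 0 := by
    have h1 : (1 - (2 * R + 1) ^ (-c)) * (1 - (2 * R + 1) ^ (-((K : ℝ) * (c + 1)))) ≤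
        (1 - q * (2 * R + 1)) * (1 - q ^ K) :=
      (mul_le_mul_of_nonneg_left (by linarith) (by linarith)).trans
        (mul_le_mul_of_nonneg_right (by linarith) (by linarith))
    have h2 := mul_le_mul_of_nonneg_right h1 (by linarith : 0 ≤ α / 2)
    have h3 := mul_le_mul_of_nonneg_left hsum hα.le
    rw [hθ1] at h3
    nlinarith
  rw [hw K, div_le_div_iff₀ (by positivity) (by positivity)]
  have := Real.exp_le_exp.2 hz
  nlinarith
end

section
/- Consider the scalar quadratic data-mixing instance with L_T(θ, w) = w·θ²/2 + (1−w)·(θ−1)²/2 and L_V(θ) = θ²/2, run with inner updates θ_{k,t+1} = θ_{k,t} − η ∂_θ L_T(θ_{k,t}, w_k) (0 < η < 1), θ_{k+1,0} = θ_{k,T}, and weight updates w_{k+1} = w_k / (w_k + (1−w_k) exp(α ḡ_{k,T})) where ḡ_{k,T} = ∂L_V(θ_{k,T})/∂w_k and α > 0. Fix the total parameter-update budget N, start from w_0 = 1/2 and θ_{0,0} = −R with R > R̄ := ηN / ((1−η)(1 − (1−η)^N)). If T = 1 (so K = N weight updates are performed), then the final weight satisfies w_N < 1/2; moreover, as R →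 ∞ the final weight w_N tends to 0 (while the optimal weight is 1). -/
open Real Filter

/-- Scalar quadratic data-mixing instance, greedy case `T = 1`
(Case 2 of the formal version of Theorem 1).  For each initialization scale
`R`, the algorithm starts from `θ_{0,0} = -R`, `w₀ = 1/2` and alternates, for
`k = 0,…,N-1`, one inner gradient-descent step on
`L_T(θ,w) = w θ²/2 + (1-w)(θ-1)²/2` with step size `η` followed by one
exponentiated-gradient weight update with step size `α` using the exact
hypergradient `ḡ_{k,1} = -θ_{k+1}(1-(1-η)) = -θ_{k+1}·η`.
Then `w_N < 1/2` whenever `R > R̄ := ηN/((1-η)(1-(1-η)^N))`, and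
`w_N → 0` as `R → ∞` (while the optimal weight is `1`). -/
theorem stmt_3
    (η α : ℝ) (hη0 : 0 < η) (hη1 : η < 1) (hα : 0 < α)
    (N : ℕ) (hN : 0 < N)
    -- `θ R k`, `w R k` : the iterates of the `T = 1` algorithm started at `-R`
    (θ : ℝ → ℕ → ℝ) (w : ℝ → ℕ → ℝ)
    (hθ0 : ∀ R, θ R 0 = -R) (hw0 : ∀ R, w R 0 = 1 / 2)
    (hθupd : ∀ R k, θ R (k + 1) =
      θ R k - η * (w R k * θ R k + (1 - w R k) * (θ R k - 1)))
    (hwupd : ∀ R k, w R (k + 1) =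
      w R k / (w R k + (1 - w R k) * Real.exp (α * (-(θ R (k + 1)) * η)))) :
    (∀ R : ℝ, η * N / ((1 - η) * (1 - (1 - η) ^ N)) < R → w R N < 1 / 2) ∧
    Tendsto (fun R : ℝ => w R N) atTop (nhds 0) := by
  have key : ∀ R k, θ R k ≤ -(1 - η) ^ k * R + 1 ∧
      ∃ s : ℝ, s ≤ -R * (1 - η) * (1 - (1 - η) ^ k) + η * k ∧
        w R k = 1 / (1 + Real.exp (-(α * s))) := by
    intro R k
    induction k with
    | zero =>
      refine ⟨by rw [hθ0]; simp, 0, by simp, ?_⟩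
      rw [hw0]; norm_num
    | succ k ih =>
      obtain ⟨h1, s, hs, hw⟩ := ih
      have hwpos : 0 < w R k := by rw [hw]; positivity
      have h2 : θ R (k + 1) ≤ -(1 - η) ^ (k + 1) * R + 1 := by
        rw [hθupd, pow_succ]
        have a := mul_le_mul_of_nonneg_left h1 (sub_pos.2 hη1).le
        have b := mul_pos hη0 hwpos
        nlinarith
      refine ⟨h2, s + η * θ R (k + 1), ?_, ?_⟩
      · have a := mul_le_mul_of_nonneg_left h2 hη0.le
        rw [pow_succ] at a ⊢
        push_cast
        nlinarith
      · rw [hwupd]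
        have e : Real.exp (-(α * (s + η * θ R (k + 1)))) =
            Real.exp (-(α * s)) * Real.exp (α * (-(θ R (k + 1)) * η)) := by
          rw [← Real.exp_add]; congr 1; ring
        rw [e, hw]
        have p1 := Real.exp_pos (-(α * s))
        have p2 := Real.exp_pos (α * (-(θ R (k + 1)) * η))
        generalize Real.exp (-(α * s)) = x at *
        generalize Real.exp (α * (-(θ R (k + 1)) * η)) = y at *
        have h3 : 1 - 1 / (1 + x) = x / (1 + x) := by field_simp; ring
        rw [h3]
        have h4 : 1 / (1 + x) + x / (1 + x) * y = (1 + x * y) / (1 + x) := by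
          field_simp
        rw [h4]
        have h5 : 0 < 1 + x * y := by positivity
        field_simp
  have hD : 0 < (1 - η) * (1 - (1 - η) ^ N) := by
    have : (1 - η) ^ N < 1 := pow_lt_one₀ (by linarith) (by linarith) hN.ne'
    exact mul_pos (by linarith) (by linarith)
  constructor
  · intro R hR
    obtain ⟨-, s, hs, hw⟩ := key R N
    rw [div_lt_iff₀ hD] at hR
    have hs0 : s < 0 := by nlinarith
    have : 1 < Real.exp (-(α * s)) := by
      rw [Real.one_lt_exp_iff]; nlinarith
    rw [hw]
    exact one_div_lt_one_div_of_lt (by norm_num) (by linarith)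
  · have lim : Tendsto (fun R : ℝ => Real.exp
        (-(α * ((1 - η) * (1 - (1 - η) ^ N)) * R + -(α * (η * N))))) atTop (nhds 0) := by
      apply Real.tendsto_exp_neg_atTop_nhds_zero.comp
      exact tendsto_atTop_add_const_right _ _
        (tendsto_id.const_mul_atTop (mul_pos hα hD))
    refine squeeze_zero (fun R => ?_) (fun R => ?_) lim
    · obtain ⟨-, s, hs, hw⟩ := key R N
      rw [hw]; positivity
    · obtain ⟨-, s, hs, hw⟩ := key R N
      have a := mul_le_mul_of_nonneg_left hs hα.le
      calc w R N ≤ 1 / Real.exp (-(α * s)) := by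
            rw [hw]
            exact one_div_le_one_div_of_le (Real.exp_pos _) (by linarith)
        _ = Real.exp (α * s) := by rw [Real.exp_neg]; simp
        _ ≤ _ := by
            apply Real.exp_le_exp.2
            nlinarith
end

section
/- Suppose each ℓ_j : ℝ^d → ℝ (j ∈ [m]) is L-smooth and μ-strongly convex, with minimizers θ*_{(j)} = argmin_θ ℓ_j(θ) satisfying max_{i,j} ‖θ*_{(i)} − θ*_{(j)}‖₂ ≤ D. For w ∈ Δ^m let θ*(w) = argmin_θ Σ_j w^{(j)} ℓ_j(θ). Then for all w, w' ∈ Δ^m, ‖θ*(w) − θ*(w')‖₂ ≤ (2L/μ + 1) D. -/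
open Real Finset
open scoped RealInnerProductSpace

/-- A gradient vanishes at a global minimizer. -/
lemma grad_zero_of_min {d : ℕ} {f : EuclideanSpace ℝ (Fin d) → ℝ} {g x : EuclideanSpace ℝ (Fin d)}
    (hf : HasGradientAt f g x) (hmin : ∀ y, f x ≤ f y) : g = 0 := by
  have h1 : IsLocalMin f x := Filter.Eventually.of_forall hmin
  have h2 := h1.hasFDerivAt_eq_zero hf.hasFDerivAt
  simpa using h2

/-- Stability of the weighted-loss minimizer across weight
vectors (Lemma 7 of the paper).  If each `ℓ j` is `L`-smooth and
`μ`-strongly convex with minimizers at pairwise distance at most `D`, then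
the minimizers of the weighted training losses for any two weight vectors in
the simplex are within distance `(2L/μ + 1)·D`. -/
theorem stmt_12
    (d m : ℕ) (hm : 1 ≤ m)
    (L μ D : ℝ) (hL : 0 < L) (hμ : 0 < μ) (hD : 0 ≤ D)
    (ℓ : Fin m → EuclideanSpace ℝ (Fin d) → ℝ)
    (gradℓ : Fin m → EuclideanSpace ℝ (Fin d) → EuclideanSpace ℝ (Fin d))
    (hgrad : ∀ j x, HasGradientAt (ℓ j) (gradℓ j x) x)
    (hsmooth : ∀ j x y, ‖gradℓ j x - gradℓ j y‖ ≤ L * ‖x - y‖)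
    (hsc : ∀ j x y, ℓ j x + ⟪gradℓ j x, y - x⟫ + μ / 2 * ‖y - x‖ ^ 2 ≤ ℓ j y)
    -- minimizers of the individual losses, with pairwise distances ≤ D
    (θmin : Fin m → EuclideanSpace ℝ (Fin d))
    (hθmin : ∀ j x, ℓ j (θmin j) ≤ ℓ j x)
    (hDbound : ∀ i j, ‖θmin i - θmin j‖ ≤ D)
    -- θstar w : the minimizer of the weighted training loss L_T(·, w)
    (θstar : (Fin m → ℝ) → EuclideanSpace ℝ (Fin d))
    (hθstar : ∀ w : Fin m → ℝ, (∀ j, 0 ≤ w j) → (∑ j, w j) = 1 →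
      ∀ x, ∑ j, w j * ℓ j (θstar w) ≤ ∑ j, w j * ℓ j x) :
    ∀ w w' : Fin m → ℝ, (∀ j, 0 ≤ w j) → (∑ j, w j) = 1 →
      (∀ j, 0 ≤ w' j) → (∑ j, w' j) = 1 →
      ‖θstar w - θstar w'‖ ≤ (2 * L / μ + 1) * D := by
  have key : ∀ w : Fin m → ℝ, (∀ j, 0 ≤ w j) → (∑ j, w j) = 1 →
      ‖θstar w - θmin ⟨0, hm⟩‖ ≤ L / μ * D := by
    intro w hw hs
    set θ := θstar w
    set p := θmin ⟨0, hm⟩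
    have hG : HasGradientAt (fun x => ∑ j, w j * ℓ j x) (∑ j, w j • gradℓ j θ) θ := by
      rw [hasGradientAt_iff_hasFDerivAt, map_sum]
      refine HasFDerivAt.fun_sum fun j _ => ?_
      have := ((hgrad j θ).hasFDerivAt).const_mul (w j)
      simpa using this
    have hG0 := grad_zero_of_min hG (hθstar w hw hs)
    have hmin0 : ∀ j, gradℓ j (θmin j) = 0 := fun j => grad_zero_of_min (hgrad j _) (hθmin j)
    have hb : ∀ j, ‖gradℓ j p‖ ≤ L * D := by
      intro j
      have h1 := hsmooth j p (θmin j)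
      rw [hmin0, sub_zero] at h1
      exact h1.trans (mul_le_mul_of_nonneg_left (hDbound _ _) hL.le)
    have hmono : ∀ j, μ * ‖θ - p‖ ^ 2 ≤ ⟪gradℓ j θ, θ - p⟫ + L * D * ‖θ - p‖ := by
      intro j
      have h1 := hsc j θ p
      have h2 := hsc j p θ
      have h3 : ⟪gradℓ j θ, p - θ⟫ = - ⟪gradℓ j θ, θ - p⟫ := by
        rw [← inner_neg_right, neg_sub]
      rw [h3, norm_sub_rev p θ] at h1
      have h4 : -⟪gradℓ j p, θ - p⟫ ≤ L * D * ‖θ - p‖ := by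
        calc -⟪gradℓ j p, θ - p⟫ ≤ |⟪gradℓ j p, θ - p⟫| := neg_le_abs _
          _ ≤ ‖gradℓ j p‖ * ‖θ - p‖ := abs_real_inner_le_norm _ _
          _ ≤ _ := mul_le_mul_of_nonneg_right (hb j) (norm_nonneg _)
      linarith
    have hsum : ∑ j, w j * (μ * ‖θ - p‖ ^ 2) ≤
        ∑ j, w j * (⟪gradℓ j θ, θ - p⟫ + L * D * ‖θ - p‖) :=
      Finset.sum_le_sum fun j _ => mul_le_mul_of_nonneg_left (hmono j) (hw j)
    have hz : ∑ j, w j * ⟪gradℓ j θ, θ - p⟫ = 0 := by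
      have : ⟪∑ j, w j • gradℓ j θ, θ - p⟫ = 0 := by rw [hG0, inner_zero_left]
      rw [sum_inner] at this
      simpa [real_inner_smul_left] using this
    simp only [mul_add] at hsum
    rw [Finset.sum_add_distrib, hz, ← Finset.sum_mul, ← Finset.sum_mul, hs] at hsum
    rw [div_mul_eq_mul_div, le_div_iff₀ hμ]
    rcases (norm_nonneg (θ - p)).eq_or_lt with h | h
    · rw [← h, zero_mul]; positivity
    · refine le_of_mul_le_mul_right ?_ h
      nlinarith
  intro w w' hw hs hw' hs'
  have h1 := key w hw hs
  have h2 := key w' hw' hs'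
  rw [norm_sub_rev] at h2
  have h3 := norm_sub_le_norm_sub_add_norm_sub (θstar w) (θmin ⟨0, hm⟩) (θstar w')
  have h4 : (2 * L / μ + 1) * D = L / μ * D + L / μ * D + D := by ring
  linarith
end

section
/- Suppose each ℓ_j : ℝ^d → ℝ (j ∈ [m]) is L-smooth and μ-strongly convex, with minimizers θ*_{(j)} = argmin_θ ℓ_j(θ) satisfying max_{i,j} ‖θ*_{(i)} − θ*_{(j)}‖₂ ≤ D. For w ∈ Δ^m let θ* = θ*(w) = argmin_θ Σ_j w^{(j)} ℓ_j(θ). Then the weighted average of squared distances to the domain minimizers satisfies Σ_{j=1}^m w^{(j)} ‖θ* − θ*_{(j)}‖₂² ≤ (L/μ)² D². -/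
open Real Finset
open scoped RealInnerProductSpace

/-- The weighted average of squared distances from the
weighted-loss minimizer to the individual domain minimizers is at most
`(L/μ)² D²` (the key estimate inside Lemma 7 of the paper). -/
theorem stmt_13
    (d m : ℕ) (hm : 1 ≤ m)
    (L μ D : ℝ) (hL : 0 < L) (hμ : 0 < μ) (hD : 0 ≤ D)
    (ℓ : Fin m → EuclideanSpace ℝ (Fin d) → ℝ)
    (gradℓ : Fin m → EuclideanSpace ℝ (Fin d) → EuclideanSpace ℝ (Fin d))
    (hgrad : ∀ j x, HasGradientAt (ℓ j) (gradℓ j x) x)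
    (hsmooth : ∀ j x y, ‖gradℓ j x - gradℓ j y‖ ≤ L * ‖x - y‖)
    (hsc : ∀ j x y, ℓ j x + ⟪gradℓ j x, y - x⟫ + μ / 2 * ‖y - x‖ ^ 2 ≤ ℓ j y)
    -- minimizers of the individual losses, with pairwise distances ≤ D
    (θmin : Fin m → EuclideanSpace ℝ (Fin d))
    (hθmin : ∀ j x, ℓ j (θmin j) ≤ ℓ j x)
    (hDbound : ∀ i j, ‖θmin i - θmin j‖ ≤ D)
    -- θstar : the minimizer of the weighted training loss L_T(·, w)
    (w : Fin m → ℝ) (hw0 : ∀ j, 0 ≤ w j) (hw1 : ∑ j, w j = 1)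
    (θstar : EuclideanSpace ℝ (Fin d))
    (hθstar : ∀ x, ∑ j, w j * ℓ j θstar ≤ ∑ j, w j * ℓ j x) :
    ∑ j, w j * ‖θstar - θmin j‖ ^ 2 ≤ (L / μ) ^ 2 * D ^ 2 := by
  have hg0 : ∀ j, gradℓ j (θmin j) = 0 := by
    intro j
    have h1 := (hgrad j (θmin j)).hasFDerivAt
    have h2 : IsLocalMin (ℓ j) (θmin j) := Filter.Eventually.of_forall (hθmin j)
    have h3 := h2.hasFDerivAt_eq_zero h1
    simpa using h3
  have hsum : ∀ v, ∑ j, w j * ⟪gradℓ j θstar, v⟫ = 0 := by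
    intro v
    have h1 : HasFDerivAt (fun x => ∑ j, w j * ℓ j x)
        (∑ j, w j • (InnerProductSpace.toDual ℝ _ (gradℓ j θstar))) θstar :=
      HasFDerivAt.fun_sum fun j _ => ((hgrad j θstar).hasFDerivAt).const_mul (w j)
    have h2 : IsLocalMin (fun x => ∑ j, w j * ℓ j x) θstar := Filter.Eventually.of_forall hθstar
    have h3 := congrArg (fun f => f v) (h2.hasFDerivAt_eq_zero h1)
    simpa using h3
  let i : Fin m := ⟨0, hm⟩
  have key : ∀ j, w j * (μ * ‖θstar - θmin j‖ ^ 2) ≤ w j * ⟪gradℓ j θstar, θstar - θmin i⟫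
      + w j * (μ / 2 * ‖θstar - θmin j‖ ^ 2 + L ^ 2 * D ^ 2 / (2 * μ)) := by
    intro j
    rw [← mul_add]
    refine mul_le_mul_of_nonneg_left ?_ (hw0 j)
    have a := hsc j θstar (θmin j)
    have b := hsc j (θmin j) θstar
    rw [hg0 j, inner_zero_left] at b
    rw [norm_sub_rev] at a
    have e1 : ⟪gradℓ j θstar, θstar - θmin i⟫ + ⟪gradℓ j θstar, θmin i - θmin j⟫
        = - ⟪gradℓ j θstar, θmin j - θstar⟫ := by
      rw [← inner_add_right, ← inner_neg_right]; congr 1; abel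
    have c := real_inner_le_norm (gradℓ j θstar) (θmin i - θmin j)
    have g := hsmooth j θstar (θmin j)
    rw [hg0 j, sub_zero] at g
    have c2 : ‖gradℓ j θstar‖ * ‖θmin i - θmin j‖ ≤ (L * ‖θstar - θmin j‖) * D :=
      mul_le_mul g (hDbound i j) (norm_nonneg _) (by positivity)
    have c3 : (L * ‖θstar - θmin j‖) * D
        ≤ μ / 2 * ‖θstar - θmin j‖ ^ 2 + L ^ 2 * D ^ 2 / (2 * μ) := by
      have : μ / 2 * ‖θstar - θmin j‖ ^ 2 + L ^ 2 * D ^ 2 / (2 * μ) - (L * ‖θstar - θmin j‖) * D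
        = (μ * ‖θstar - θmin j‖ - L * D) ^ 2 / (2 * μ) := by field_simp; ring
      have h : 0 ≤ (μ * ‖θstar - θmin j‖ - L * D) ^ 2 / (2 * μ) := by positivity
      linarith
    linarith
  have T := Finset.sum_le_sum fun j (_ : j ∈ Finset.univ) => key j
  rw [Finset.sum_add_distrib, hsum, zero_add] at T
  simp only [mul_add, Finset.sum_add_distrib, ← Finset.sum_mul, hw1, mul_left_comm (w _),
    ← Finset.mul_sum] at T
  set S := ∑ j, w j * ‖θstar - θmin j‖ ^ 2
  have T2 : μ / 2 * S ≤ L ^ 2 * D ^ 2 / (2 * μ) := by linarith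
  have e : (L / μ) ^ 2 * D ^ 2 = L ^ 2 * D ^ 2 / (2 * μ) / (μ / 2) := by field_simp
  rw [e, le_div_iff₀ (by positivity)]
  linarith
end
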